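/- There is no Z-homotopy of degree 6 between a Chebyshev polynomial whose two fiber multiplicity multisets are {3,3} and {2,1,1,1,1} and a Chebyshev polynomial whose two fiber multiplicity multisets are {3,1,1,1} and {2,2,2}. Precisely: there is no map λ ↦ p_λ from [0,1] to ℂ[X] with deg p_λ = 6 for all λ and all coefficients continuous in λ, such that (i) p_0 has exactly two distinct critical values α ≠ β with the multiset of root multiplicities of p_0 − α equal to {3,3} and of p_0 − β equal to {2,1,1,1,1}; (ii) p_1 has exactly two distinct critical values γ ≠ δ with the multiset of root multiplicities of p_1 − γ equal to {3,1,1,1} and of p_1 − δ equal to {2,2,2}; (iii) p_λ has exactly three distinct critical values for all λ ∈ (0,1). (This is the statement that the 6-edge plane trees T_6 and T_12 are not Z-homotopic.) -/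

import Mathlib

open Polynomial

/-- The set of critical values of a polynomial `p`: values of `p` at the roots of `p'`. -/
noncomputable def criticalValues (p : ℂ[X]) : Set ℂ :=
  (fun x => p.eval x) '' {x : ℂ | p.derivative.eval x = 0}

/-- The multiset of multiplicities of the roots of `p - α` (one entry per distinct root). -/
noncomputable def fiberMults (p : ℂ[X]) (α : ℂ) : Multiset ℕ :=
  (p - C α).roots.toFinset.val.map fun x => (p - C α).rootMultiplicity x

open Filter Topology

namespace ZH

lemma exists_perm_of_map_eq {f g : Fin 5 → ℂ}
    (h : (Finset.univ.val.map f : Multiset ℂ) = Finset.univ.val.map g) :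
    ∃ σ : Equiv.Perm (Fin 5), ∀ i, g (σ i) = f i := by
  classical
  have hc : ∀ y : ℂ, Nonempty ({a // f a = y} ≃ {b // g b = y}) := by
    intro y
    rw [← Fintype.card_eq]
    have := congrArg (Multiset.count y) h
    rw [Multiset.count_map, Multiset.count_map] at this
    rw [Fintype.card_subtype, Fintype.card_subtype]
    simpa [Finset.card, Finset.filter_val, eq_comm] using this
  let e : ∀ y, {a // f a = y} ≃ {b // g b = y} := fun y => (hc y).some
  exact ⟨Equiv.ofFiberEquiv e, fun i => Equiv.ofFiberEquiv_map e i⟩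

lemma exists_tuple {s : Multiset ℂ} (h : Multiset.card s = 5) :
    ∃ c : Fin 5 → ℂ, s = Finset.univ.val.map c := by
  induction s using Quotient.inductionOn with
  | h l =>
    have h' : l.length = 5 := by simpa using h
    refine ⟨fun i => l.get (Fin.cast h'.symm i), ?_⟩
    rw [Fin.univ_val_map]
    change (l : Multiset ℂ) = _
    congr 1
    apply List.ext_get
    · simp [h']
    · intro n h1 h2
      rw [List.get_ofFn]
      rfl

/-- eval converges along a filter. -/
lemma tendsto_eval {L : Filter ℝ} {p : ℝ → ℂ[X]} {q : ℂ[X]} {x : ℝ → ℂ} {y : ℂ} (n : ℕ)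
    (hp : ∀ᶠ t in L, (p t).natDegree ≤ n) (hq : q.natDegree ≤ n)
    (hc : ∀ i, Tendsto (fun t => (p t).coeff i) L (𝓝 (q.coeff i)))
    (hx : Tendsto x L (𝓝 y)) :
    Tendsto (fun t => (p t).eval (x t)) L (𝓝 (q.eval y)) := by
  rw [eval_eq_sum_range' (Nat.lt_succ_of_le hq)]
  have : Tendsto (fun t => ∑ i ∈ Finset.range (n+1), (p t).coeff i * (x t) ^ i) L
      (𝓝 (∑ i ∈ Finset.range (n+1), q.coeff i * y ^ i)) :=
    tendsto_finsetSum _ fun i _ => (hc i).mul (hx.pow i)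
  refine this.congr' ?_
  filter_upwards [hp] with t ht
  rw [eval_eq_sum_range' (Nat.lt_succ_of_le ht)]

lemma dvd_limit {L : Filter ℝ} [L.NeBot] {c : ℝ → Fin 5 → ℂ} {c0 : Fin 5 → ℂ} (n : ℕ)
    (hcc : ∀ k, Tendsto (fun t => c t k) L (𝓝 (c0 k))) (l : List (Fin 5)) :
    ∀ (p : ℝ → ℂ[X]) (q : ℂ[X]), (∀ᶠ t in L, (p t).natDegree ≤ n) → q.natDegree ≤ n →
    (∀ i, Tendsto (fun t => (p t).coeff i) L (𝓝 (q.coeff i))) →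
    (∀ᶠ t in L, (l.map fun k => X - C (c t k)).prod ∣ p t) →
    (l.map fun k => X - C (c0 k)).prod ∣ q := by
  induction l with
  | nil => intros; simp
  | cons k l ih =>
    intro p q hp hq hc hd
    have hroot : q.IsRoot (c0 k) := by
      have h1 := tendsto_eval n hp hq hc (hcc k)
      refine tendsto_nhds_unique h1 (tendsto_const_nhds.congr' ?_)
      filter_upwards [hd] with t ht
      rw [List.map_cons, List.prod_cons] at ht
      exact (dvd_iff_isRoot.1 (dvd_of_mul_right_dvd ht)).symm
    have key : ∀ (a : ℂ) (r : ℂ[X]), r.natDegree ≤ n → ∀ m,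
        (r /ₘ (X - C a)).coeff m = ∑ i ∈ Finset.Icc (m+1) n, a ^ (i - (m+1)) * r.coeff i := by
      intro a r hr m
      rw [coeff_divByMonic_X_sub_C]
      refine Finset.sum_subset (Finset.Icc_subset_Icc_right hr) ?_
      intro i hi hi'
      rw [coeff_eq_zero_of_natDegree_lt, mul_zero]
      simp only [Finset.mem_Icc] at hi hi'
      omega
    have := ih (fun t => p t /ₘ (X - C (c t k))) (q /ₘ (X - C (c0 k))) ?_ ?_ ?_ ?_
    · rw [List.map_cons, List.prod_cons, ← mul_divByMonic_eq_iff_isRoot.2 hroot]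
      exact mul_dvd_mul_left _ this
    · filter_upwards [hp] with t ht
      rw [natDegree_divByMonic _ (monic_X_sub_C _)]; omega
    · rw [natDegree_divByMonic _ (monic_X_sub_C _)]; omega
    · intro m
      rw [key _ _ hq]
      refine Tendsto.congr' (f₁ := fun t => ∑ i ∈ Finset.Icc (m+1) n, (c t k) ^ (i - (m+1)) * (p t).coeff i) ?_ ?_
      · filter_upwards [hp] with t ht
        rw [key _ _ ht]
      · exact tendsto_finsetSum _ fun i _ => ((hcc k).pow _).mul (hc i)
    · filter_upwards [hd] with t ht
      rw [List.map_cons, List.prod_cons] at ht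
      have hr := mul_divByMonic_eq_iff_isRoot.2 (dvd_iff_isRoot.1 (dvd_of_mul_right_dvd ht))
      rw [← hr] at ht
      exact (mul_dvd_mul_iff_left (X_sub_C_ne_zero _)).1 ht

/-- root tuple of the derivative -/
def RT (p : ℂ[X]) (c : Fin 5 → ℂ) : Prop := p.derivative.roots = Finset.univ.val.map c

lemma natDegree_der {p : ℂ[X]} (h : p.natDegree = 6) : p.derivative.natDegree = 5 := by
  rw [natDegree_derivative, h]

lemma card_roots_der {p : ℂ[X]} (h : p.natDegree = 6) :
    Multiset.card p.derivative.roots = 5 := by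
  rw [← natDegree_der h]
  exact (splits_iff_card_roots.1 (IsAlgClosed.splits _))

lemma exists_RT {p : ℂ[X]} (h : p.natDegree = 6) : ∃ c, RT p c := exists_tuple (card_roots_der h)

lemma RT.factor {p : ℂ[X]} {c : Fin 5 → ℂ} (h : p.natDegree = 6) (hc : RT p c) :
    p.derivative = C (p.derivative.coeff 5) * ∏ i, (X - C (c i)) := by
  have h1 := C_leadingCoeff_mul_prod_multiset_X_sub_C (p := p.derivative)
    (by rw [card_roots_der h, natDegree_der h])
  rw [hc, leadingCoeff, natDegree_der h, Multiset.map_map] at h1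
  exact h1.symm

lemma RT.of_factor {p : ℂ[X]} {c : Fin 5 → ℂ} {a : ℂ} (ha : a ≠ 0)
    (hc : p.derivative = C a * ∏ i, (X - C (c i))) : RT p c := by
  unfold RT
  rw [hc, roots_C_mul _ ha]
  have := roots_multiset_prod_X_sub_C (Finset.univ.val.map c)
  rw [Multiset.map_map] at this
  exact this

lemma RT.critVal {p : ℂ[X]} {c : Fin 5 → ℂ} (h : p.natDegree = 6) (hc : RT p c) :
    criticalValues p = Set.range fun i => p.eval (c i) := by
  have h0 : p.derivative ≠ 0 := by
    intro h0; have := natDegree_der h; rw [h0] at this; simp at this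
  have : ∀ x, p.derivative.eval x = 0 ↔ ∃ i, c i = x := by
    intro x
    have := mem_roots h0 (a := x)
    rw [hc] at this
    rw [Multiset.mem_map] at this
    rw [← IsRoot.def, ← this]
    simp only [Finset.mem_val, Finset.mem_univ, true_and]
  ext y
  simp only [criticalValues, Set.mem_image, Set.mem_ofPred_eq, this, Set.mem_range]
  constructor
  · rintro ⟨x, ⟨i, rfl⟩, rfl⟩; exact ⟨i, rfl⟩
  · rintro ⟨i, rfl⟩; exact ⟨_, ⟨i, rfl⟩, rfl⟩

lemma root_bound {q : ℂ[X]} (h : q.natDegree = 5) {x : ℂ} (hx : q.IsRoot x) :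
    ‖x‖ ≤ (∑ i ∈ Finset.range 5, ‖q.coeff i‖) / ‖q.coeff 5‖ + 1 := by
  have h0 : q ≠ 0 := by rintro rfl; simp at h
  have h1 : ‖x‖ ≤ (cauchyBound q : ℝ) := by exact_mod_cast (IsRoot.norm_lt_cauchyBound h0 hx).le
  refine h1.trans ?_
  rw [cauchyBound, leadingCoeff, h]
  push_cast
  gcongr
  have : (Finset.range 5).sup (fun i => ‖q.coeff i‖₊) ≤ ∑ i ∈ Finset.range 5, ‖q.coeff i‖₊ := by
    refine Finset.sup_le fun i hi => ?_
    exact Finset.single_le_sum (f := fun i => ‖q.coeff i‖₊) (fun _ _ => zero_le) hi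
  exact_mod_cast this

/-- Continuity of the roots of the derivative along an ultrafilter. -/
lemma exists_tendsto_RT {U : Ultrafilter ℝ} {p : ℝ → ℂ[X]} {q : ℂ[X]}
    (hp : ∀ᶠ t in (U : Filter ℝ), (p t).natDegree = 6) (hq : q.natDegree = 6)
    (hc : ∀ i, Tendsto (fun t => (p t).coeff i) U (𝓝 (q.coeff i)))
    {c0 : Fin 5 → ℂ} (h0 : RT q c0) :
    ∃ c : ℝ → Fin 5 → ℂ, (∀ᶠ t in (U : Filter ℝ), RT (p t) (c t)) ∧
      ∀ k, Tendsto (fun t => c t k) U (𝓝 (c0 k)) := by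
  have hex : ∀ t, ∃ c, (p t).natDegree = 6 → RT (p t) c := by
    intro t
    by_cases h : (p t).natDegree = 6
    · obtain ⟨c, hc⟩ := exists_RT h; exact ⟨c, fun _ => hc⟩
    · exact ⟨0, fun h' => absurd h' h⟩
  choose c hcR using hex
  have hcR' : ∀ᶠ t in (U : Filter ℝ), RT (p t) (c t) := hp.mono fun t ht => hcR t ht
  have hdc : ∀ i, Tendsto (fun t => (p t).derivative.coeff i) U (𝓝 (q.derivative.coeff i)) := by
    intro i
    simp only [coeff_derivative]
    exact (hc _).mul_const _
  have hlead : q.derivative.coeff 5 ≠ 0 := by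
    rw [← natDegree_der hq]
    apply leadingCoeff_ne_zero.2
    intro h0; have := natDegree_der hq; rw [h0] at this; simp at this
  set B : ℂ[X] → ℝ := fun q => (∑ i ∈ Finset.range 5, ‖q.coeff i‖) / ‖q.coeff 5‖ + 1 with hB
  have hBt : Tendsto (fun t => B (p t).derivative) U (𝓝 (B q.derivative)) := by
    refine Tendsto.add_const _ (Tendsto.div ?_ (hdc 5).norm (norm_ne_zero_iff.2 hlead))
    exact tendsto_finsetSum _ fun i _ => (hdc i).norm
  have hBe : ∀ᶠ t in (U : Filter ℝ), B (p t).derivative < B q.derivative + 1 :=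
    hBt.eventually_lt_const (by linarith)
  have hbd : ∀ᶠ t in (U : Filter ℝ), c t ∈ Metric.closedBall (0 : Fin 5 → ℂ) (B q.derivative + 1) := by
    filter_upwards [hBe, hp, hcR'] with t ht hpt hct
    rw [mem_closedBall_zero_iff, pi_norm_le_iff_of_nonempty]
    intro i
    have hr : c t i ∈ (p t).derivative.roots := by
      rw [hct]; exact Multiset.mem_map_of_mem _ (Finset.mem_univ i)
    exact (root_bound (natDegree_der hpt) (isRoot_of_mem_roots hr)).trans ht.le
  obtain ⟨cs, -, hcs⟩ := (isCompact_closedBall (0 : Fin 5 → ℂ) (B q.derivative + 1)).ultrafilter_le_nhds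
    (U.map c) (le_principal_iff.2 hbd)
  have hcs' : Tendsto c U (𝓝 cs) := hcs
  rw [tendsto_pi_nhds] at hcs'
  have hRs : RT q cs := by
    refine RT.of_factor hlead ?_
    apply Polynomial.funext
    intro x
    have h1 : Tendsto (fun t => (p t).derivative.eval x) U (𝓝 (q.derivative.eval x)) :=
      tendsto_eval 5 (hp.mono fun t ht => (natDegree_der ht).le) (natDegree_der hq).le hdc
        tendsto_const_nhds
    have h2 : Tendsto (fun t => (p t).derivative.coeff 5 * ∏ i, (x - c t i)) U
        (𝓝 (q.derivative.coeff 5 * ∏ i, (x - cs i))) :=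
      (hdc 5).mul (tendsto_finsetProd _ fun i _ => (hcs' i).const_sub x)
    have h3 := tendsto_nhds_unique h1 (h2.congr' (by
      filter_upwards [hp, hcR'] with t ht hct
      conv_rhs => rw [hct.factor ht]
      simp [eval_prod]))
    rw [h3]; simp [eval_prod]
  obtain ⟨σ, hσ⟩ := exists_perm_of_map_eq (h0.symm.trans hRs)
  refine ⟨fun t i => c t (σ i), ?_, fun k => ?_⟩
  · filter_upwards [hcR'] with t ht
    unfold RT at ht ⊢
    rw [ht]
    have := Multiset.map_univ_val_equiv σ
    conv_lhs => rw [← this]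
    rw [Multiset.map_map]; rfl
  · rw [← hσ]; exact hcs' (σ k)


/-- Many critical points with a common value give many roots. -/
lemma dvd_of_same_value {p : ℂ[X]} {c : Fin 5 → ℂ} (h : p.natDegree = 6) (hc : RT p c)
    (J : Finset (Fin 5)) {i j : Fin 5} (hi : i ∈ J) (hj : j ∈ J) (hij : c i ≠ c j)
    {w : ℂ} (hw : ∀ k ∈ J, p.eval (c k) = w) :
    ((J.toList ++ [i, j]).map fun k => X - C (c k)).prod ∣ p - C w := by
  classical
  have h0 : p - C w ≠ 0 := by
    intro h0
    have : (p - C w).natDegree = 6 := by rw [natDegree_sub_C, h]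
    rw [h0] at this; simp at this
  have hle : (J.val.map c + {c i, c j} : Multiset ℂ) ≤ (p - C w).roots := by
    rw [Multiset.le_iff_count]
    intro y
    by_cases hy : y ∈ J.val.map c
    · obtain ⟨k, hk, rfl⟩ := Multiset.mem_map.1 hy
      have hroot : (p - C w).IsRoot (c k) := by simp [IsRoot, hw k hk]
      have h1 := derivative_rootMultiplicity_of_root hroot
      have h2 : 0 < rootMultiplicity (c k) (p - C w) := (rootMultiplicity_pos h0).2 hroot
      rw [derivative_sub, derivative_C, sub_zero, ← count_roots, hc] at h1
      have h3 : Multiset.count (c k) (J.val.map c) ≤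
          Multiset.count (c k) (Finset.univ.val.map c) :=
        Multiset.count_le_of_le _ (Multiset.map_le_map (Finset.val_le_iff.2 (Finset.subset_univ J)))
      have h4 : Multiset.count (c k) {c i, c j} ≤ 1 := by
        refine Multiset.nodup_iff_count_le_one.1 (?_ : Multiset.Nodup {c i, c j}) (c k)
        simpa using hij
      rw [Multiset.count_add, count_roots]
      omega
    · rw [Multiset.count_eq_zero_of_notMem]
      · exact Nat.zero_le _
      · simp only [Multiset.mem_add, not_or]
        refine ⟨hy, ?_⟩
        intro hy'
        simp only [Multiset.insert_eq_cons, Multiset.mem_cons, Multiset.mem_singleton] at hy'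
        rcases hy' with rfl | rfl
        · exact hy (Multiset.mem_map_of_mem _ hi)
        · exact hy (Multiset.mem_map_of_mem _ hj)
  have := (Multiset.prod_X_sub_C_dvd_iff_le_roots h0 _).2 hle
  convert this using 1
  rw [Multiset.map_add, Multiset.prod_add, List.map_append, List.prod_append, Multiset.map_map]
  congr 1
  exact Finset.prod_map_toList J _

/-- The key lemma: critical points with a common value do not merge. -/
lemma no_merge {U : Ultrafilter ℝ} {p : ℝ → ℂ[X]} {q : ℂ[X]}
    (hp : ∀ᶠ t in (U : Filter ℝ), (p t).natDegree = 6) (hq : q.natDegree = 6)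
    (hco : ∀ i, Tendsto (fun t => (p t).coeff i) U (𝓝 (q.coeff i)))
    {c0 : Fin 5 → ℂ} (h0 : RT q c0) {c : ℝ → Fin 5 → ℂ}
    (hc : ∀ᶠ t in (U : Filter ℝ), RT (p t) (c t))
    (hcc : ∀ k, Tendsto (fun t => c t k) U (𝓝 (c0 k)))
    {i j : Fin 5} (hij : c0 i = c0 j)
    (hv : ∀ᶠ t in (U : Filter ℝ), ∀ k, c0 k = c0 i → (p t).eval (c t k) = (p t).eval (c t i)) :
    ∀ᶠ t in (U : Filter ℝ), c t i = c t j := by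
  classical
  by_contra hne
  rw [← Ultrafilter.eventually_not] at hne
  set J : Finset (Fin 5) := Finset.univ.filter fun k => c0 k = c0 i with hJ
  have hval : Tendsto (fun t => (p t).eval (c t i)) U (𝓝 (q.eval (c0 i))) :=
    tendsto_eval 6 (hp.mono fun t ht => ht.le) hq.le hco (hcc i)
  have hdvd := dvd_limit 6 hcc (J.toList ++ [i, j])
    (fun t => p t - C ((p t).eval (c t i))) (q - C (q.eval (c0 i)))
    (by filter_upwards [hp] with t ht; rw [natDegree_sub_C, ht])
    (by rw [natDegree_sub_C, hq])
    (by
      intro m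
      simp only [coeff_sub, coeff_C]
      refine (hco m).sub ?_
      split_ifs
      · exact hval
      · exact tendsto_const_nhds)
    (by
      filter_upwards [hp, hc, hne, hv] with t h1 h2 h3 h4
      refine dvd_of_same_value h1 h2 J (by simp [hJ]) (by simp [hJ, hij]) h3 ?_
      intro k hk
      exact h4 k (by simpa [hJ] using hk))
  have hpow : ((J.toList ++ [i, j]).map fun k => X - C (c0 k)).prod = (X - C (c0 i)) ^ (J.card + 2) := by
    rw [List.prod_eq_pow_card _ (X - C (c0 i))]
    · simp
    · intro x hx
      rw [List.mem_map] at hx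
      obtain ⟨k, hk, rfl⟩ := hx
      rw [List.mem_append, Finset.mem_toList] at hk
      rcases hk with hk | hk
      · rw [(Finset.mem_filter.1 hk).2]
      · simp only [List.mem_cons, List.not_mem_nil, or_false] at hk
        rcases hk with rfl | rfl
        · rfl
        · rw [hij]
  rw [hpow] at hdvd
  have hn0 : q - C (q.eval (c0 i)) ≠ 0 := by
    intro h0
    have : (q - C (q.eval (c0 i))).natDegree = 6 := by rw [natDegree_sub_C, hq]
    rw [h0] at this; simp at this
  have hmult := (le_rootMultiplicity_iff hn0).2 hdvd
  have hroot : (q - C (q.eval (c0 i))).IsRoot (c0 i) := by simp [IsRoot]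
  have h1 := derivative_rootMultiplicity_of_root hroot
  rw [derivative_sub, derivative_C, sub_zero, ← count_roots, h0, Multiset.count_map] at h1
  have h2 : Multiset.card (Finset.univ.val.filter fun k => c0 i = c0 k) = J.card := by
    rw [hJ, Finset.card, Finset.filter_val]
    simp only [eq_comm]
  rw [h2] at h1
  omega

open Classical in
noncomputable def pairCount (s : Multiset ℂ) : ℕ := (s.map fun x => s.count x).sum

/-- The discrete invariant. -/
noncomputable def inv (p : ℂ[X]) : ℕ :=
  pairCount p.derivative.roots + pairCount (p.derivative.roots.map fun x => p.eval x)

open Classical in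
lemma pairCount_tuple (c : Fin 5 → ℂ) :
    pairCount (Finset.univ.val.map c) = ∑ i, (Finset.univ.filter fun j => c i = c j).card := by
  unfold pairCount
  rw [Multiset.map_map]
  change ∑ i, Multiset.count (c i) _ = _
  refine Finset.sum_congr rfl fun i _ => ?_
  rw [Multiset.count_map]; rfl

open Classical in
lemma inv_eq {p : ℂ[X]} {c : Fin 5 → ℂ} (hc : RT p c) :
    inv p = ∑ i, (Finset.univ.filter fun j => c i = c j).card +
      ∑ i, (Finset.univ.filter fun j => p.eval (c i) = p.eval (c j)).card := by
  unfold inv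
  rw [hc, pairCount_tuple, Multiset.map_map]
  congr 1
  exact pairCount_tuple (fun i => p.eval (c i))

lemma eventually_pattern {U : Ultrafilter ℝ} {c : ℝ → Fin 5 → ℂ} {c0 : Fin 5 → ℂ}
    (hcc : ∀ k, Tendsto (fun t => c t k) U (𝓝 (c0 k))) :
    ∀ᶠ t in (U : Filter ℝ), ∀ i j, c t i = c t j → c0 i = c0 j := by
  rw [eventually_all]; intro i
  rw [eventually_all]; intro j
  by_cases h : c0 i = c0 j
  · simp [h]
  · filter_upwards [((hcc i).sub (hcc j)).eventually_ne (sub_ne_zero.2 h)] with t ht h'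
    exact absurd (sub_eq_zero.2 h') ht

lemma exists_label {v : Fin 5 → ℂ} (h : (Set.range v).ncard = 3) :
    ∃ f : Fin 5 → Fin 3, Function.Surjective f ∧ ∀ i j, v i = v j ↔ f i = f j := by
  have e : Set.range v ≃ Fin 3 := Finite.equivFinOfCardEq (by rw [Nat.card_coe_set_eq, h])
  refine ⟨fun i => e ⟨v i, Set.mem_range_self i⟩, ?_, ?_⟩
  · intro y
    obtain ⟨⟨x, i, rfl⟩, hx⟩ := e.surjective y
    exact ⟨i, hx⟩
  · intro i j
    rw [e.apply_eq_iff_eq, Subtype.ext_iff]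

lemma pattern_eq {v w : Fin 5 → ℂ} (hv : (Set.range v).ncard = 3) (hw : (Set.range w).ncard = 3)
    (h : ∀ i j, v i = v j → w i = w j) (i j : Fin 5) : v i = v j ↔ w i = w j := by
  refine ⟨h i j, fun hij => ?_⟩
  have hft : Function.FactorsThrough w v := fun i j hij => h i j hij
  obtain ⟨g, hg⟩ := (Function.factorsThrough_iff w).1 hft
  have himg : g '' Set.range v = Set.range w := by rw [hg, Set.range_comp]
  have hinj : Set.InjOn g (Set.range v) := by
    apply Set.injOn_of_ncard_image_eq
    · rw [himg, hv, hw]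
    · exact Set.finite_range v
  apply hinj ⟨i, rfl⟩ ⟨j, rfl⟩
  rw [hg] at hij
  exact hij

lemma interior_const {U : Ultrafilter ℝ} {p : ℝ → ℂ[X]} {q : ℂ[X]}
    (hp : ∀ᶠ t in (U : Filter ℝ), (p t).natDegree = 6) (hq : q.natDegree = 6)
    (hco : ∀ i, Tendsto (fun t => (p t).coeff i) U (𝓝 (q.coeff i)))
    (h3 : ∀ᶠ t in (U : Filter ℝ), (criticalValues (p t)).ncard = 3)
    (hq3 : (criticalValues q).ncard = 3) :
    ∀ᶠ t in (U : Filter ℝ), inv (p t) = inv q := by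
  classical
  obtain ⟨c0, h0⟩ := exists_RT hq
  obtain ⟨c, hc, hcc⟩ := exists_tendsto_RT hp hq hco h0
  have hvv : ∀ k, Tendsto (fun t => (p t).eval (c t k)) U (𝓝 (q.eval (c0 k))) := fun k =>
    tendsto_eval 6 (hp.mono fun t ht => ht.le) hq.le hco (hcc k)
  have hE := eventually_pattern hcc
  have hF := eventually_pattern (c := fun t k => (p t).eval (c t k)) (c0 := fun k => q.eval (c0 k)) hvv
  have hF' : ∀ᶠ t in (U : Filter ℝ), ∀ i j,
      (p t).eval (c t i) = (p t).eval (c t j) ↔ q.eval (c0 i) = q.eval (c0 j) := by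
    filter_upwards [hF, hp, hc, h3] with t ht hpt hct h3t
    rw [hct.critVal hpt] at h3t
    rw [h0.critVal hq] at hq3
    exact pattern_eq h3t hq3 ht
  have hE' : ∀ᶠ t in (U : Filter ℝ), ∀ i j, c0 i = c0 j → c t i = c t j := by
    rw [eventually_all]; intro i
    rw [eventually_all]; intro j
    by_cases h : c0 i = c0 j
    · have := no_merge hp hq hco h0 hc hcc h (by
        filter_upwards [hF'] with t ht k hk
        rw [ht, hk])
      filter_upwards [this] with t ht _ using ht
    · simp [h]
  filter_upwards [hc, hE, hE', hF'] with t hct h1 h2 h4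
  rw [inv_eq hct, inv_eq h0]
  have h5 : ∀ i j, c t i = c t j ↔ c0 i = c0 j := fun i j => ⟨h1 i j, h2 i j⟩
  simp only [h4, h5]

lemma end_pattern {U : Ultrafilter ℝ} {p : ℝ → ℂ[X]} {q : ℂ[X]}
    (hp : ∀ᶠ t in (U : Filter ℝ), (p t).natDegree = 6) (hq : q.natDegree = 6)
    (hco : ∀ i, Tendsto (fun t => (p t).coeff i) U (𝓝 (q.coeff i)))
    (h3 : ∀ᶠ t in (U : Filter ℝ), (criticalValues (p t)).ncard = 3)
    {c0 : Fin 5 → ℂ} (h0 : RT q c0) (e : Fin 5 → Fin 4) (he : ∀ i j, c0 i = c0 j ↔ e i = e j)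
    (he2 : ∀ i j k, e i = e j → i ≠ j → e k = e i → k = i ∨ k = j) :
    ∀ᶠ t in (U : Filter ℝ), ∃ f : Fin 5 → Fin 3, Function.Surjective f ∧
      (∀ i j, f i = f j → q.eval (c0 i) = q.eval (c0 j)) ∧
      inv (p t) = ∑ i, (Finset.univ.filter fun j => e i = e j ∧ f i = f j).card +
        ∑ i, (Finset.univ.filter fun j => f i = f j).card := by
  classical
  obtain ⟨c, hc, hcc⟩ := exists_tendsto_RT hp hq hco h0
  have hvv : ∀ k, Tendsto (fun t => (p t).eval (c t k)) U (𝓝 (q.eval (c0 k))) := fun k =>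
    tendsto_eval 6 (hp.mono fun t ht => ht.le) hq.le hco (hcc k)
  have hE := eventually_pattern hcc
  have hF := eventually_pattern (c := fun t k => (p t).eval (c t k)) (c0 := fun k => q.eval (c0 k)) hvv
  have hE' : ∀ᶠ t in (U : Filter ℝ), ∀ i j, c0 i = c0 j →
      (p t).eval (c t i) = (p t).eval (c t j) → c t i = c t j := by
    rw [eventually_all]; intro i
    rw [eventually_all]; intro j
    by_cases h : c0 i = c0 j
    · by_cases hij : i = j
      · simp [hij]
      · by_cases hs : ∀ᶠ t in (U : Filter ℝ), (p t).eval (c t i) = (p t).eval (c t j)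
        · have := no_merge hp hq hco h0 hc hcc h (by
            filter_upwards [hs] with t ht k hk
            rcases he2 i j k ((he i j).1 h) hij ((he k i).1 hk) with rfl | rfl
            · rfl
            · exact ht.symm)
          filter_upwards [this] with t ht _ _ using ht
        · rw [← Ultrafilter.eventually_not] at hs
          filter_upwards [hs] with t ht _ h' using absurd h' ht
    · simp [h]
  filter_upwards [hp, hc, hE, hE', hF, h3] with t hpt hct h1 h2 h4 h3t
  rw [hct.critVal hpt] at h3t
  obtain ⟨f, hf, hfv⟩ := exists_label h3t
  refine ⟨f, hf, fun i j hij => h4 i j ((hfv i j).2 hij), ?_⟩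
  rw [inv_eq hct]
  have h5 : ∀ i j, c t i = c t j ↔ (e i = e j ∧ f i = f j) := fun i j =>
    ⟨fun h => ⟨(he i j).1 (h1 i j h), (hfv i j).1 (by rw [h])⟩,
     fun h => h2 i j ((he i j).2 h.1) ((hfv i j).2 h.2)⟩
  simp only [h5, hfv]

lemma comb0 : ∀ f : Fin 5 → Fin 3, Function.Surjective f → (∀ i, i ≠ 4 → f i ≠ f 4) →
    (∑ i, (Finset.univ.filter fun j => (![0,0,1,1,2] : Fin 5 → Fin 4) i = ![0,0,1,1,2] j ∧ f i = f j).card +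
        ∑ i, (Finset.univ.filter fun j => f i = f j).card) % 4 = 2 := by
  decide +kernel

lemma comb1 : ∀ f : Fin 5 → Fin 3, Function.Surjective f →
    (∀ i j, i < 2 → 2 ≤ j → f i ≠ f j) →
    (∑ i, (Finset.univ.filter fun j => (![0,0,1,2,3] : Fin 5 → Fin 4) i = ![0,0,1,2,3] j ∧ f i = f j).card +
        ∑ i, (Finset.univ.filter fun j => f i = f j).card) % 4 = 0 := by
  decide +kernel

lemma mult_der {q : ℂ[X]} (hq : q.natDegree = 6) {α x : ℂ} {m : ℕ}
    (h : (q - C α).rootMultiplicity x = m + 1) :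
    q.eval x = α ∧ q.derivative.rootMultiplicity x = m := by
  have h0 : q - C α ≠ 0 := by
    intro h0
    have : (q - C α).natDegree = 6 := by rw [natDegree_sub_C, hq]
    rw [h0] at this; simp at this
  have hr : (q - C α).IsRoot x := (rootMultiplicity_pos h0).1 (by omega)
  have h1 := derivative_rootMultiplicity_of_root hr
  rw [derivative_sub, derivative_C, sub_zero, h] at h1
  refine ⟨?_, by simpa using h1⟩
  simpa [IsRoot, sub_eq_zero] using hr

lemma RT_of_le {q : ℂ[X]} (hq : q.natDegree = 6) {c : Fin 5 → ℂ}
    (h : Finset.univ.val.map c ≤ q.derivative.roots) : RT q c := by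
  refine (Multiset.eq_of_le_of_card_le h ?_).symm
  rw [card_roots_der hq]; simp

lemma start_tuple {q : ℂ[X]} (hq : q.natDegree = 6) {α β : ℂ} (hab : α ≠ β)
    (hcv : criticalValues q = {α, β}) (hf : fiberMults q α = {3, 3}) :
    ∃ a b m : ℂ, a ≠ b ∧ a ≠ m ∧ b ≠ m ∧ RT q ![a, a, b, b, m] ∧
      q.eval a = α ∧ q.eval b = α ∧ q.eval m = β := by
  classical
  unfold fiberMults at hf
  have hcard := congrArg Multiset.card hf
  rw [Multiset.card_map] at hcard
  have hcard' : (q - C α).roots.toFinset.card = 2 := hcard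
  obtain ⟨a, b, hne, hs⟩ := Finset.card_eq_two.1 hcard'
  have h3 : ∀ x ∈ (q - C α).roots.toFinset, (q - C α).rootMultiplicity x = 3 := by
    intro x hx
    have := Multiset.mem_map_of_mem (fun x => (q - C α).rootMultiplicity x) (show x ∈ Finset.val _ from hx)
    rw [hf] at this
    simpa using this
  obtain ⟨ha, ha'⟩ := mult_der hq (h3 a (by simp [hs]))
  obtain ⟨hb, hb'⟩ := mult_der hq (h3 b (by simp [hs]))
  have hβ : β ∈ criticalValues q := by rw [hcv]; simp
  obtain ⟨m, hm, hmβ⟩ := hβ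
  have hmβ' : q.eval m = β := hmβ
  have ham : a ≠ m := by rintro rfl; exact hab (ha.symm.trans hmβ')
  have hbm : b ≠ m := by rintro rfl; exact hab (hb.symm.trans hmβ')
  refine ⟨a, b, m, hne, ham, hbm, ?_, ha, hb, hmβ'⟩
  apply RT_of_le hq
  have hd0 : q.derivative ≠ 0 := by
    intro h0; have := natDegree_der hq; rw [h0] at this; simp at this
  have hm' : 0 < q.derivative.rootMultiplicity m := (rootMultiplicity_pos hd0).2 hm
  rw [Multiset.le_iff_count]
  intro y
  rw [count_roots]
  have : (Finset.univ.val.map ![a, a, b, b, m] : Multiset ℂ) = {a, a, b, b, m} := rfl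
  rw [this]
  simp only [Multiset.insert_eq_cons, Multiset.count_cons, Multiset.count_singleton]
  by_cases h1 : y = a
  · subst h1; simp [hne, ham, ha']
  by_cases h2 : y = b
  · subst h2; simp [hne.symm, hbm, hb']
  by_cases h4 : y = m
  · subst h4; simp [ham.symm, hbm.symm]; omega
  simp [h1, h2, h4]

lemma end_tuple {q : ℂ[X]} (hq : q.natDegree = 6) {γ δ : ℂ} (hab : γ ≠ δ)
    (hf : fiberMults q γ = {3, 1, 1, 1}) (hg : fiberMults q δ = {2, 2, 2}) :
    ∃ u w1 w2 w3 : ℂ, u ≠ w1 ∧ u ≠ w2 ∧ u ≠ w3 ∧ w1 ≠ w2 ∧ w1 ≠ w3 ∧ w2 ≠ w3 ∧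
      RT q ![u, u, w1, w2, w3] ∧
      q.eval u = γ ∧ q.eval w1 = δ ∧ q.eval w2 = δ ∧ q.eval w3 = δ := by
  classical
  unfold fiberMults at hf hg
  have hu : ∃ u, (q - C γ).rootMultiplicity u = 3 := by
    have : (3 : ℕ) ∈ Multiset.map (fun x => (q - C γ).rootMultiplicity x) (q - C γ).roots.toFinset.val := by
      rw [hf]; simp
    obtain ⟨u, -, hu⟩ := Multiset.mem_map.1 this
    exact ⟨u, hu⟩
  obtain ⟨u, hu⟩ := hu
  have hcard := congrArg Multiset.card hg
  rw [Multiset.card_map] at hcard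
  have hcard' : (q - C δ).roots.toFinset.card = 3 := hcard
  obtain ⟨w1, w2, w3, h12, h13, h23, hs⟩ := Finset.card_eq_three.1 hcard'
  have h3 : ∀ x ∈ (q - C δ).roots.toFinset, (q - C δ).rootMultiplicity x = 2 := by
    intro x hx
    have := Multiset.mem_map_of_mem (fun x => (q - C δ).rootMultiplicity x) (show x ∈ Finset.val _ from hx)
    rw [hg] at this
    simpa using this
  obtain ⟨hu, hu'⟩ := mult_der hq hu
  obtain ⟨ha, ha'⟩ := mult_der hq (h3 w1 (by simp [hs]))
  obtain ⟨hb, hb'⟩ := mult_der hq (h3 w2 (by simp [hs]))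
  obtain ⟨hc, hc'⟩ := mult_der hq (h3 w3 (by simp [hs]))
  have hu1 : u ≠ w1 := by rintro rfl; exact hab (hu.symm.trans ha)
  have hu2 : u ≠ w2 := by rintro rfl; exact hab (hu.symm.trans hb)
  have hu3 : u ≠ w3 := by rintro rfl; exact hab (hu.symm.trans hc)
  refine ⟨u, w1, w2, w3, hu1, hu2, hu3, h12, h13, h23, ?_, hu, ha, hb, hc⟩
  apply RT_of_le hq
  rw [Multiset.le_iff_count]
  intro y
  rw [count_roots]
  have : (Finset.univ.val.map ![u, u, w1, w2, w3] : Multiset ℂ) = {u, u, w1, w2, w3} := rfl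
  rw [this]
  simp only [Multiset.insert_eq_cons, Multiset.count_cons, Multiset.count_singleton]
  by_cases h0 : y = u
  · subst h0; simp [hu1, hu2, hu3, hu']
  by_cases h1 : y = w1
  · subst h1; simp [hu1.symm, h12, h13, ha']
  by_cases h2 : y = w2
  · subst h2; simp [hu2.symm, h12.symm, h23, hb']
  by_cases h4 : y = w3
  · subst h4; simp [hu3.symm, h13.symm, h23.symm, hc']
  simp [h0, h1, h2, h4]

end ZH

/-- The 6-edge plane trees `T₆` (fiber multiplicity multisets `{3,3}` and `{2,1,1,1,1}`)
and `T₁₂` (fiber multiplicity multisets `{3,1,1,1}` and `{2,2,2}`) are not Z-homotopic. -/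
theorem T6_T12_not_Zhomotopic :
    ¬ ∃ p : ℝ → ℂ[X],
      (∀ t ∈ Set.Icc (0 : ℝ) 1, (p t).degree = 6) ∧
      (∀ i : ℕ, ContinuousOn (fun t => (p t).coeff i) (Set.Icc (0 : ℝ) 1)) ∧
      (∃ α β : ℂ, α ≠ β ∧ criticalValues (p 0) = {α, β} ∧
        fiberMults (p 0) α = {3, 3} ∧ fiberMults (p 0) β = {2, 1, 1, 1, 1}) ∧
      (∃ γ δ : ℂ, γ ≠ δ ∧ criticalValues (p 1) = {γ, δ} ∧
        fiberMults (p 1) γ = {3, 1, 1, 1} ∧ fiberMults (p 1) δ = {2, 2, 2}) ∧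
      (∀ t ∈ Set.Ioo (0 : ℝ) 1, (criticalValues (p t)).ncard = 3) := by
  rintro ⟨p, hdeg, hcont, ⟨α, β, hαβ, hcv0, hα, -⟩, ⟨γ, δ, hγδ, -, hγ, hδ⟩, h3⟩
  have hnd : ∀ t ∈ Set.Icc (0 : ℝ) 1, (p t).natDegree = 6 := fun t ht =>
    natDegree_eq_of_degree_eq_some (hdeg t ht)
  -- setup along an ultrafilter
  have hset : ∀ t0 ∈ Set.Icc (0 : ℝ) 1, ∀ U : Ultrafilter ℝ, (U : Filter ℝ) ≤ 𝓝[Set.Ioo 0 1] t0 →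
      (∀ᶠ t in (U : Filter ℝ), (p t).natDegree = 6) ∧
      (∀ i, Tendsto (fun t => (p t).coeff i) U (𝓝 ((p t0).coeff i))) ∧
      (∀ᶠ t in (U : Filter ℝ), (criticalValues (p t)).ncard = 3) ∧
      (∀ᶠ t in (U : Filter ℝ), t ∈ Set.Ioo (0 : ℝ) 1) := by
    intro t0 ht0 U hU
    have hmem : ∀ᶠ t in (U : Filter ℝ), t ∈ Set.Ioo (0 : ℝ) 1 := hU self_mem_nhdsWithin
    refine ⟨hmem.mono fun t ht => hnd t (Set.Ioo_subset_Icc_self ht), fun i => ?_,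
      hmem.mono fun t ht => h3 t ht, hmem⟩
    exact (hcont i t0 ht0).mono_left
      (hU.trans (nhdsWithin_mono _ Set.Ioo_subset_Icc_self))
  -- the invariant is constant on the open interval
  have hconst : ∀ s ∈ Set.Ioo (0 : ℝ) 1, ∀ t ∈ Set.Ioo (0 : ℝ) 1,
      ZH.inv (p s) = ZH.inv (p t) := by
    intro s hs t ht
    have hco : ContinuousOn (fun t => ZH.inv (p t)) (Set.Ioo (0 : ℝ) 1) := by
      intro t0 ht0
      rw [ContinuousWithinAt, nhds_discrete, tendsto_pure]
      refine mem_iff_ultrafilter.2 fun U hU => ?_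
      have ht0' := Set.Ioo_subset_Icc_self ht0
      obtain ⟨h1, h2, h4, -⟩ := hset t0 ht0' U hU
      exact ZH.interior_const h1 (hnd t0 ht0') h2 h4 (h3 t0 ht0)
    exact isPreconnected_Ioo.constant hco hs ht
  -- left end
  have hleft : ∃ t ∈ Set.Ioo (0 : ℝ) 1, ZH.inv (p t) % 4 = 2 := by
    have h0 : (0 : ℝ) ∈ Set.Icc (0 : ℝ) 1 := by simp
    have hne : (𝓝[Set.Ioo (0 : ℝ) 1] 0).NeBot := left_nhdsWithin_Ioo_neBot one_pos
    obtain ⟨U, hU⟩ := Ultrafilter.exists_le (𝓝[Set.Ioo (0 : ℝ) 1] (0 : ℝ))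
    obtain ⟨h1, h2, h4, h5⟩ := hset 0 h0 U hU
    obtain ⟨a, b, m, hab, ham, hbm, hRT, ha, hb, hm⟩ := ZH.start_tuple (hnd 0 h0) hαβ hcv0 hα
    have hp := ZH.end_pattern h1 (hnd 0 h0) h2 h4 hRT ![0, 0, 1, 1, 2]
      (by
        intro i j
        fin_cases i <;> fin_cases j <;>
          simp [hab, ham, hbm, hab.symm, ham.symm, hbm.symm])
      (by decide)
    obtain ⟨t, ⟨f, hf, hf', hinv⟩, ht⟩ := (hp.and h5).exists
    refine ⟨t, ht, ?_⟩
    rw [hinv]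
    refine ZH.comb0 f hf ?_
    intro i hi h
    have := hf' i 4 h
    fin_cases i <;> simp [ha, hb, hm, hαβ] at this hi
  -- right end
  have hright : ∃ t ∈ Set.Ioo (0 : ℝ) 1, ZH.inv (p t) % 4 = 0 := by
    have h0 : (1 : ℝ) ∈ Set.Icc (0 : ℝ) 1 := by simp
    have hne : (𝓝[Set.Ioo (0 : ℝ) 1] 1).NeBot := right_nhdsWithin_Ioo_neBot one_pos
    obtain ⟨U, hU⟩ := Ultrafilter.exists_le (𝓝[Set.Ioo (0 : ℝ) 1] (1 : ℝ))
    obtain ⟨h1, h2, h4, h5⟩ := hset 1 h0 U hU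
    obtain ⟨u, w1, w2, w3, hu1, hu2, hu3, h12, h13, h23, hRT, hu, hw1, hw2, hw3⟩ :=
      ZH.end_tuple (hnd 1 h0) hγδ hγ hδ
    have hp := ZH.end_pattern h1 (hnd 1 h0) h2 h4 hRT ![0, 0, 1, 2, 3]
      (by
        intro i j
        fin_cases i <;> fin_cases j <;>
          simp [hu1, hu2, hu3, h12, h13, h23, hu1.symm, hu2.symm, hu3.symm, h12.symm,
            h13.symm, h23.symm])
      (by decide)
    obtain ⟨t, ⟨f, hf, hf', hinv⟩, ht⟩ := (hp.and h5).exists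
    refine ⟨t, ht, ?_⟩
    rw [hinv]
    refine ZH.comb1 f hf ?_
    intro i j hi hj h
    have := hf' i j h
    fin_cases i <;> fin_cases j <;> simp [hu, hw1, hw2, hw3, hγδ] at this hi hj
  obtain ⟨s, hs, hs'⟩ := hleft
  obtain ⟨t, ht, ht'⟩ := hright
  rw [hconst s hs t ht] at hs'
  omega
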